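/- Lemma 4 (joint typicality over multiple rounds). Let Z, U, W be finite alphabets. There exists a constant C > 0, depending only on |Z|, |U|, |W|, such that the following holds for every n ≥ 2 and every j ≥ 1. Fix τ ∈ P_n(W) and σ ∈ P_n(U ≫ W); let M_1, …, M_j be finite index sets with |M_i| ≥ 8·j·ln j for each i; let w_m ∈ T_τ for each m ∈ ∪_{i=1}^j M_i; and let (U_m)_{m ∈ ∪_i M_i} be independent random sequences with U_m uniformly distributed on T_σ(w_m). Then for all ν_1, …, ν_j ∈ P_n(Z|U; στ) and all z_1, …, z_j ∈ Z^n such that z_i ∈ T_{ν_i σ}(w_m) for every m ∈ M_i and every i: log₂ Pr( ∩_{i=1}^j { z_i ∈ ∪_{m ∈ M_i} T_{ν_i}(U_m) } ) ≥ Σ_{i=1}^j min( log₂|M_i| − n·I(ν_i, σ|τ), 0 ) − C·j·log₂(n·j). -/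

import Mathlib

open scoped BigOperators

noncomputable section

namespace Types

/-- `t` is a (row-stochastic) channel from `A` to `B`. -/
def IsChannel {A B : Type*} [Fintype B] (t : A → B → ℝ) : Prop :=
  (∀ a b, 0 ≤ t a b) ∧ ∀ a, ∑ b, t a b = 1

/-- `σ ∈ P(U ≫ W)`: for every `u` there is at most one `w` with `σ(u|w) > 0`. -/
def Deterministic {U W : Type*} (σ : W → U → ℝ) : Prop :=
  ∀ u w w', 0 < σ w u → 0 < σ w' u → w = w'

/-- The number of indices at which the sequence `x` takes the value `a`. -/
def cnt {X : Type*} [DecidableEq X] {n : ℕ} (x : Fin n → X) (a : X) : ℕ :=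
  (Finset.univ.filter fun i => x i = a).card

/-- The number of indices at which `x` takes the value `a` and `y` the value `b`. -/
def cnt2 {X Y : Type*} [DecidableEq X] [DecidableEq Y] {n : ℕ}
    (x : Fin n → X) (y : Fin n → Y) (a : X) (b : Y) : ℕ :=
  (Finset.univ.filter fun i => x i = a ∧ y i = b).card

/-- The empirical distribution `p_x` of the sequence `x`. -/
def empDist {X : Type*} [DecidableEq X] {n : ℕ} (x : Fin n → X) : X → ℝ :=
  fun a => (cnt x a : ℝ) / (n : ℝ)

/-- The conditional empirical distribution `p_{y|x}` (junk value `0` where the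
conditioning count vanishes). -/
def condEmp {X Y : Type*} [DecidableEq X] [DecidableEq Y] {n : ℕ}
    (x : Fin n → X) (y : Fin n → Y) : X → Y → ℝ :=
  fun a b => (cnt2 x y a b : ℝ) / (cnt x a : ℝ)

/-- `y ∈ T_ν(x)`: the conditional empirical distribution of `y` given `x` is
`ν`, expressed by counts: `#{i : x i = a, y i = b} = #{i : x i = a}·ν(b|a)`
for all `a, b`. -/
def InTypeClass {X Y : Type*} [DecidableEq X] [DecidableEq Y] {n : ℕ}
    (ν : X → Y → ℝ) (x : Fin n → X) (y : Fin n → Y) : Prop :=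
  ∀ a b, (cnt2 x y a b : ℝ) = (cnt x a : ℝ) * ν a b

open Classical in
/-- The type class `T_ν(x)` as a finite set. -/
def typeFinset {X Y : Type*} [DecidableEq X] [DecidableEq Y] [Fintype Y] {n : ℕ}
    (ν : X → Y → ℝ) (x : Fin n → X) : Finset (Fin n → Y) :=
  Finset.univ.filter fun y => InTypeClass ν x y

/-- Composition of a channel `μ : U → Y` with an input channel `σ : W → U`:
`(μσ)(y|w) = ∑ u, σ(u|w) μ(y|u)`. -/
def comp {U W Y : Type*} [Fintype U] (μ : U → Y → ℝ) (σ : W → U → ℝ) :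
    W → Y → ℝ :=
  fun w y => ∑ u, σ w u * μ u y

/-- Output distribution of `σ : W → U` under the input distribution `τ`. -/
def marg {U W : Type*} [Fintype W] (σ : W → U → ℝ) (τ : W → ℝ) : U → ℝ :=
  fun u => ∑ w, τ w * σ w u

/-- Conditional mutual information `I(μ, σ | τ)` (base-2). -/
def condMutInfo {U W Y : Type*} [Fintype U] [Fintype W] [Fintype Y]
    (μ : U → Y → ℝ) (σ : W → U → ℝ) (τ : W → ℝ) : ℝ :=
  ∑ w, ∑ u, ∑ y, τ w * σ w u * μ u y * Real.logb 2 (μ u y / comp μ σ w y)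

/-- `τ ∈ P_n(A)`: a probability distribution whose masses are multiples of `1/n`. -/
def IsTypeDist {A : Type*} [Fintype A] (n : ℕ) (τ : A → ℝ) : Prop :=
  ((∀ a, 0 ≤ τ a) ∧ ∑ a, τ a = 1) ∧ ∀ a, ∃ m : ℕ, τ a = (m : ℝ) / (n : ℝ)

/-- `ρ ∈ P_n(B|A; π)`: a channel with `ρ(b|a)·n·π(a) ∈ ℕ` for all `a, b`. -/
def IsCondType {A B : Type*} [Fintype A] [Fintype B] (n : ℕ)
    (π : A → ℝ) (ρ : A → B → ℝ) : Prop :=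
  IsChannel ρ ∧ ∀ a b, ∃ m : ℕ, ρ a b * ((n : ℝ) * π a) = (m : ℝ)



open Finset in
lemma exists_equiv_comp {α β C : Type*} [Fintype α] [Fintype β] [DecidableEq C]
    (p : α → C) (q : β → C)
    (h : ∀ c, (univ.filter fun a => p a = c).card = (univ.filter fun b => q b = c).card) :
    ∃ e : α ≃ β, ∀ a, q (e a) = p a := by
  classical
  have e : ∀ c, Nonempty ({a // p a = c} ≃ {b // q b = c}) := by
    intro c
    refine ⟨Fintype.equivOfCardEq ?_⟩
    rw [Fintype.card_subtype, Fintype.card_subtype]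
    exact h c
  exact ⟨Equiv.ofFiberEquiv fun c => (e c).some, fun a => Equiv.ofFiberEquiv_map _ a⟩

open Finset Equiv in
lemma perm_count {α C : Type*} [Fintype α] [DecidableEq α] [DecidableEq C]
    (p q : α → C)
    (h : ∀ c, (univ.filter fun a => p a = c).card = (univ.filter fun b => q b = c).card) :
    (univ.filter fun g : Perm α => p ∘ g = q).card
      = (univ.filter fun g : Perm α => p ∘ g = p).card := by
  obtain ⟨e, he⟩ := exists_equiv_comp q p (fun c => (h c).symm)
  symm
  refine Finset.card_equiv (Equiv.mulRight e) ?_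
  intro g
  simp only [mem_filter, mem_univ, true_and, Equiv.coe_mulRight]
  constructor
  · intro hg
    funext a
    have := congrFun hg (e a)
    simp only [Function.comp_apply, Perm.coe_mul] at this ⊢
    rw [this, he]
  · intro hg
    funext a
    have := congrFun hg (e.symm a)
    simp only [Function.comp_apply, Perm.coe_mul, Equiv.apply_symm_apply] at this ⊢
    rw [this, ← he, Equiv.apply_symm_apply]

open Finset Equiv in
lemma stab_card {α C : Type*} [Fintype α] [DecidableEq α] [Fintype C] [DecidableEq C]
    (p : α → C) :
    (univ.filter fun g : Perm α => p ∘ g = p).card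
      = ∏ c, Nat.factorial (univ.filter fun a => p a = c).card := by
  have := DomMulAct.stabilizer_card (f := p)
  rw [Fintype.card_subtype] at this
  rw [this]
  refine prod_congr rfl fun c _ => ?_
  rw [Fintype.card_subtype]

lemma cnt2_eq {X Y : Type*} [DecidableEq X] [DecidableEq Y] {n : ℕ}
    (x : Fin n → X) (y : Fin n → Y) (c : X × Y) :
    (Finset.univ.filter fun i => (x i, y i) = c).card = cnt2 x y c.1 c.2 := by
  unfold cnt2
  congr 1
  ext i
  simp [Prod.ext_iff]

open Finset Equiv in
lemma card_class {X Y : Type*} [Fintype X] [Fintype Y] [DecidableEq X] [DecidableEq Y] {n : ℕ}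
    (x : Fin n → X) (y₀ : Fin n → Y) :
    (univ.filter fun y : Fin n → Y => ∀ a b, cnt2 x y a b = cnt2 x y₀ a b).card
      * ∏ c : X × Y, Nat.factorial (cnt2 x y₀ c.1 c.2) = ∏ a, Nat.factorial (cnt x a) := by
  have h1 := stab_card x
  have h2 := stab_card (fun i => (x i, y₀ i))
  simp only [cnt2_eq] at h2
  unfold cnt
  rw [← h1, ← h2]
  have hmaps : Set.MapsTo (fun g : Perm (Fin n) => y₀ ∘ g)
      ((univ.filter fun g : Perm (Fin n) => x ∘ g = x : Finset (Perm (Fin n))) : Set (Perm (Fin n)))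
      ((univ.filter fun y : Fin n → Y => ∀ a b, cnt2 x y a b = cnt2 x y₀ a b :
        Finset (Fin n → Y)) : Set (Fin n → Y)) := by
    intro g hg
    simp only [coe_filter, mem_univ, true_and, Set.mem_ofPred_eq] at hg ⊢
    intro a b
    unfold cnt2
    refine Finset.card_equiv g ?_
    intro i
    have := congrFun hg i
    simp only [Function.comp_apply] at this
    simp [this]
  rw [Finset.card_eq_sum_card_fiberwise hmaps]
  symm
  apply Finset.sum_const_nat
  intro y hy
  rw [mem_filter] at hy
  rw [← perm_count (fun i => (x i, y₀ i)) (fun i => (x i, y i))]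
  · congr 1
    ext g
    simp [funext_iff, Prod.ext_iff, forall_and]
  · intro c
    rw [cnt2_eq, cnt2_eq, hy.2]

open Finset in
lemma exists_counts {X Y : Type*} [Fintype X] [Fintype Y] [DecidableEq X] [DecidableEq Y] {n : ℕ}
    (x : Fin n → X) (N : X → Y → ℕ) (hN : ∀ a, cnt x a = ∑ b, N a b) :
    ∃ y : Fin n → Y, ∀ a b, cnt2 x y a b = N a b := by
  obtain ⟨e, he⟩ := exists_equiv_comp x
    (fun s : (Σ a : X, Σ b : Y, Fin (N a b)) => s.1) (by
      intro a
      rw [← Fintype.card_subtype (fun s : (Σ a : X, Σ b : Y, Fin (N a b)) => s.1 = a)]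
      rw [Fintype.card_congr (Equiv.sigmaSubtype a)]
      simp only [Fintype.card_sigma, Fintype.card_fin]
      exact hN a)
  refine ⟨fun i => (e i).2.1, ?_⟩
  intro a b
  unfold cnt2
  rw [← Fintype.card_fin (N a b)]
  rw [← Finset.card_univ]
  symm
  refine Finset.card_bij (fun k _ => e.symm ⟨a, b, k⟩) ?_ ?_ ?_
  · intro k _
    simp only [mem_filter, mem_univ, true_and]
    rw [← he]
    have h := e.apply_symm_apply ⟨a, b, k⟩
    constructor
    · rw [h]
    · rw [h]
  · intro k _ k' _ h
    have := e.symm.injective h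
    simpa using this
  · intro i hi
    simp only [mem_filter, mem_univ, true_and] at hi
    obtain ⟨h1, h2⟩ := hi
    rw [← he] at h1
    rcases hs : e i with ⟨a', b', k⟩
    rw [hs] at h1 h2
    simp only at h1 h2
    subst h1 h2
    refine ⟨k, mem_univ _, ?_⟩
    rw [← hs]; simp

lemma cnt2_sum_right {X Y : Type*} [DecidableEq X] [DecidableEq Y] [Fintype Y] {n : ℕ}
    (x : Fin n → X) (y : Fin n → Y) (a : X) : ∑ b, cnt2 x y a b = cnt x a := by
  unfold cnt cnt2
  rw [Finset.card_eq_sum_card_fiberwise (t := Finset.univ) (f := y) (by simp)]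
  simp [Finset.filter_filter]

lemma cnt2_sum_left {X Y : Type*} [DecidableEq X] [DecidableEq Y] [Fintype X] {n : ℕ}
    (x : Fin n → X) (y : Fin n → Y) (b : Y) : ∑ a, cnt2 x y a b = cnt y b := by
  unfold cnt cnt2
  rw [Finset.card_eq_sum_card_fiberwise (t := Finset.univ) (f := x) (by simp)]
  simp [Finset.filter_filter, and_comm]

lemma cnt2_le {X Y : Type*} [DecidableEq X] [DecidableEq Y] {n : ℕ}
    (x : Fin n → X) (y : Fin n → Y) (a : X) (b : Y) : cnt2 x y a b ≤ n := by
  unfold cnt2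
  exact (Finset.card_le_univ _).trans (by simp)

lemma cnt_le {X : Type*} [DecidableEq X] {n : ℕ}
    (x : Fin n → X) (a : X) : cnt x a ≤ n := by
  unfold cnt
  exact (Finset.card_le_univ _).trans (by simp)

lemma log_fact_lower (k : ℕ) : (k : ℝ) * Real.log k - k ≤ Real.log (k.factorial) := by
  rcases Nat.eq_zero_or_pos k with rfl | hk
  · simp
  have hk' : (0 : ℝ) < k := by exact_mod_cast hk
  have hf : (0 : ℝ) < k.factorial := by exact_mod_cast k.factorial_pos
  have h := Real.pow_div_factorial_le_exp (x := (k : ℝ)) hk'.le k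
  have h2 := Real.log_le_log (by positivity) h
  rw [Real.log_exp, Real.log_div (by positivity) (by positivity), Real.log_pow] at h2
  linarith

lemma log_fact_upper (k : ℕ) :
    Real.log (k.factorial) ≤ (k : ℝ) * Real.log k - k + Real.log k + 1 := by
  induction k with
  | zero => simp
  | succ k ih =>
    rcases Nat.eq_zero_or_pos k with rfl | hk
    · simp
    have hk' : (0 : ℝ) < k := by exact_mod_cast hk
    have hf : (0 : ℝ) < k.factorial := by exact_mod_cast k.factorial_pos
    rw [Nat.factorial_succ]
    push_cast
    rw [Real.log_mul (by positivity) (by positivity)]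
    have h := Real.log_le_sub_one_of_pos (x := (k : ℝ) / (k + 1)) (by positivity)
    rw [Real.log_div (by positivity) (by positivity)] at h
    have h3 : ((k : ℝ) + 1) * (Real.log k - Real.log (k + 1)) ≤ -1 := by
      calc _ ≤ ((k : ℝ) + 1) * (k / (k + 1) - 1) := by gcongr
        _ = -1 := by field_simp; ring
    linarith

lemma log_fact_upper' (n k : ℕ) (_hn : 1 ≤ n) (hk : k ≤ n) :
    Real.log (k.factorial) ≤ (k : ℝ) * Real.log k - k + (Real.log n + 1) := by
  have h := log_fact_upper k
  have : Real.log k ≤ Real.log n := by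
    rcases Nat.eq_zero_or_pos k with rfl | hk0
    · simp
      exact Real.log_natCast_nonneg n
    · exact Real.log_le_log (by exact_mod_cast hk0) (by exact_mod_cast hk)
  linarith

lemma entropy_bound {Z U W : Type*} [Fintype Z] [Fintype U] [Fintype W]
    (n : ℕ) (hn : 1 ≤ n) (N : W → U → Z → ℕ) (A : W → ℕ) (B : W → U → ℕ) (G : W → Z → ℕ)
    (hB : ∀ a b, ∑ c, N a b c = B a b) (hG : ∀ a c, ∑ b, N a b c = G a c)
    (hA : ∀ a, ∑ b, B a b = A a) (hAn : ∀ a, A a ≤ n) (hNn : ∀ a b c, N a b c ≤ n) :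
    -(∑ a, ∑ b, ∑ c, (N a b c : ℝ) *
        (Real.log (N a b c) + Real.log (A a) - Real.log (B a b) - Real.log (G a c)))
      - ((Fintype.card W * Fintype.card U * Fintype.card Z + Fintype.card W : ℕ) : ℝ)
          * (Real.log n + 1)
    ≤ (∑ a, ∑ c, Real.log ((G a c).factorial) - ∑ a, ∑ b, ∑ c, Real.log ((N a b c).factorial))
      - (∑ a, Real.log ((A a).factorial) - ∑ a, ∑ b, Real.log ((B a b).factorial)) := by
  have hB' : ∀ a b, ∑ c, (N a b c : ℝ) = B a b := fun a b => by rw [← hB]; push_cast; rfl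
  have hG' : ∀ a c, ∑ b, (N a b c : ℝ) = G a c := fun a c => by rw [← hG]; push_cast; rfl
  have hA' : ∀ a, ∑ b, (B a b : ℝ) = A a := fun a => by rw [← hA]; push_cast; rfl
  have e1 : ∑ a, ∑ b, ∑ c, (N a b c : ℝ) * Real.log (A a) = ∑ a, (A a : ℝ) * Real.log (A a) := by
    refine Finset.sum_congr rfl fun a _ => ?_
    simp only [← Finset.sum_mul, hB', hA']
  have e2 : ∑ a, ∑ b, ∑ c, (N a b c : ℝ) * Real.log (B a b)
      = ∑ a, ∑ b, (B a b : ℝ) * Real.log (B a b) := by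
    refine Finset.sum_congr rfl fun a _ => ?_
    simp only [← Finset.sum_mul, hB']
  have e3 : ∑ a, ∑ b, ∑ c, (N a b c : ℝ) * Real.log (G a c)
      = ∑ a, ∑ c, (G a c : ℝ) * Real.log (G a c) := by
    refine Finset.sum_congr rfl fun a _ => ?_
    rw [Finset.sum_comm]
    simp only [← Finset.sum_mul, hG']
  have e4 : ∑ a, ∑ b, ∑ c, (N a b c : ℝ) = ∑ a, ∑ c, (G a c : ℝ) := by
    refine Finset.sum_congr rfl fun a _ => ?_
    rw [Finset.sum_comm]
    simp only [hG']
  have e5 : ∑ a, ∑ b, (B a b : ℝ) = ∑ a, (A a : ℝ) := by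
    simp only [hA']
  have b1 : ∑ a, ∑ c, ((G a c : ℝ) * Real.log (G a c) - G a c)
      ≤ ∑ a, ∑ c, Real.log ((G a c).factorial) :=
    Finset.sum_le_sum fun a _ => Finset.sum_le_sum fun c _ => log_fact_lower _
  have b2 : ∑ a, ∑ b, ((B a b : ℝ) * Real.log (B a b) - B a b)
      ≤ ∑ a, ∑ b, Real.log ((B a b).factorial) :=
    Finset.sum_le_sum fun a _ => Finset.sum_le_sum fun c _ => log_fact_lower _
  have b3 : ∑ a, Real.log ((A a).factorial)
      ≤ ∑ a, ((A a : ℝ) * Real.log (A a) - A a + (Real.log n + 1)) :=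
    Finset.sum_le_sum fun a _ => log_fact_upper' n _ hn (hAn a)
  have b4 : ∑ a, ∑ b, ∑ c, Real.log ((N a b c).factorial)
      ≤ ∑ a, ∑ b, ∑ c, ((N a b c : ℝ) * Real.log (N a b c) - N a b c + (Real.log n + 1)) :=
    Finset.sum_le_sum fun a _ => Finset.sum_le_sum fun b _ => Finset.sum_le_sum fun c _ =>
      log_fact_upper' n _ hn (hNn a b c)
  simp only [Finset.sum_add_distrib, Finset.sum_sub_distrib, mul_add, mul_sub, e1, e2, e3, e4, e5,
    Finset.sum_const, Finset.card_univ, nsmul_eq_mul] at b1 b2 b3 b4 ⊢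
  push_cast
  linarith

open Finset in
lemma cnt3_sum_z {Z U W : Type*} [Fintype Z] [DecidableEq Z] [DecidableEq U] [DecidableEq W]
    {n : ℕ} (w : Fin n → W) (z : Fin n → Z) (u : Fin n → U) (a : W) (b : U) :
    ∑ c, cnt2 (fun i => (w i, z i)) u (a, c) b = cnt2 w u a b := by
  unfold cnt2
  rw [Finset.card_eq_sum_card_fiberwise (s := univ.filter fun i => w i = a ∧ u i = b)
    (t := Finset.univ) (f := z) (by simp)]
  refine sum_congr rfl fun c _ => ?_
  congr 1
  ext i
  simp
  tauto

open Finset in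
lemma cnt3_sum_w {Z U W : Type*} [Fintype W] [DecidableEq Z] [DecidableEq U] [DecidableEq W]
    {n : ℕ} (w : Fin n → W) (z : Fin n → Z) (u : Fin n → U) (b : U) (c : Z) :
    ∑ a, cnt2 (fun i => (w i, z i)) u (a, c) b = cnt2 u z b c := by
  unfold cnt2
  rw [Finset.card_eq_sum_card_fiberwise (s := univ.filter fun i => u i = b ∧ z i = c)
    (t := Finset.univ) (f := w) (by simp)]
  refine sum_congr rfl fun c _ => ?_
  congr 1
  ext i
  simp
  tauto

lemma comp_pos {Z U W : Type*} [Fintype U] {σ : W → U → ℝ} {ν : U → Z → ℝ}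
    (hσ : ∀ a b, 0 ≤ σ a b) (hν : ∀ b c, 0 ≤ ν b c) (a : W) (b : U) (c : Z)
    (h : 0 < σ a b * ν b c) : 0 < comp ν σ a c :=
  lt_of_lt_of_le h (Finset.single_le_sum (f := fun u => σ a u * ν u c)
    (fun _ _ => mul_nonneg (hσ _ _) (hν _ _)) (Finset.mem_univ b))

open Classical Finset in
lemma single_lower {Z U W : Type*} [Fintype Z] [Fintype U] [Fintype W]
    [DecidableEq Z] [DecidableEq U] [DecidableEq W]
    (n : ℕ) (hn : 1 ≤ n) (τ : W → ℝ) (σ : W → U → ℝ) (hτ : IsTypeDist n τ)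
    (hσ : IsCondType n τ σ) (hdet : Deterministic σ) (w : Fin n → W) (hw : empDist w = τ)
    (ν : U → Z → ℝ) (hν : IsCondType n (marg σ τ) ν) (z : Fin n → Z)
    (hz : InTypeClass (comp ν σ) w z) :
    0 < (univ.filter fun u : Fin n → U => InTypeClass σ w u).card ∧
    Real.exp (-((n : ℝ) * condMutInfo ν σ τ * Real.log 2)
      - ((Fintype.card W * Fintype.card U * Fintype.card Z + Fintype.card W : ℕ) : ℝ)
          * (Real.log n + 1)) * ((univ.filter fun u : Fin n → U => InTypeClass σ w u).card : ℝ)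
    ≤ ((univ.filter fun u : Fin n → U => InTypeClass σ w u ∧ InTypeClass ν u z).card : ℝ) := by
  have hn0 : (0 : ℝ) < n := by exact_mod_cast hn
  have hcw : ∀ a, (cnt w a : ℝ) = n * τ a := by
    intro a
    rw [← hw]; unfold empDist; field_simp
  have hτ0 := hτ.1.1
  have hσ0 := hσ.1.1
  have hσ1 := hσ.1.2
  have hν0 := hν.1.1
  have hν1 := hν.1.2
  -- integrality
  have hint : ∀ a b c, ∃ N : ℕ, (N : ℝ) = n * τ a * σ a b * ν b c := by
    intro a b c
    rcases (hσ0 a b).eq_or_lt with h | h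
    · exact ⟨0, by rw [← h]; simp⟩
    · obtain ⟨m, hm⟩ := hν.2 b c
      refine ⟨m, ?_⟩
      rw [← hm]
      have : marg σ τ b = τ a * σ a b := by
        unfold marg
        refine Finset.sum_eq_single a (fun a' _ ha' => ?_) (by simp)
        rcases (hσ0 a' b).eq_or_lt with h' | h'
        · rw [← h']; simp
        · exact absurd (hdet b a' a h' h) ha'
      rw [this]; ring
  choose N hN using hint
  have hcz : ∀ a c, cnt (fun i => (w i, z i)) (a, c) = cnt2 w z a c := fun a c => cnt2_eq w z (a, c)
  obtain ⟨u₀, hu₀⟩ := exists_counts (fun i => (w i, z i)) (fun ac b => N ac.1 b ac.2) (by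
    rintro ⟨a, c⟩
    rw [hcz]
    have := hz a c
    rw [← Nat.cast_inj (R := ℝ), this, hcw]
    push_cast
    simp only [hN, comp, Finset.mul_sum]
    exact Finset.sum_congr rfl fun b _ => by ring)
  have hG : ∀ a c, ∑ b, N a b c = cnt2 w z a c := by
    intro a c
    rw [← hcz, ← cnt2_sum_right (fun i => (w i, z i)) u₀]
    simp only [hu₀]
  have hu₀' : ∀ a b c, cnt2 (fun i => (w i, z i)) u₀ (a, c) b = N a b c := fun a b c => hu₀ (a, c) b
  have hB : ∀ a b, ∑ c, N a b c = cnt2 w u₀ a b := by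
    intro a b
    rw [← cnt3_sum_z w z]
    simp only [hu₀']
  have hBr : ∀ a b, (cnt2 w u₀ a b : ℝ) = cnt w a * σ a b := by
    intro a b
    rw [← hB]; push_cast
    simp only [hN, ← Finset.mul_sum, hν1, hcw]; ring
  have hT : (univ.filter fun u : Fin n → U => InTypeClass σ w u)
      = univ.filter fun u : Fin n → U => ∀ a b, cnt2 w u a b = cnt2 w u₀ a b := by
    ext u
    rw [mem_filter, mem_filter]
    simp only [mem_univ, true_and]
    refine forall_congr' fun a => forall_congr' fun b => ?_
    rw [← hBr, Nat.cast_inj]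
  have hsub : (univ.filter fun u : Fin n → U => ∀ ac b,
        cnt2 (fun i => (w i, z i)) u ac b = cnt2 (fun i => (w i, z i)) u₀ ac b) ⊆
      (univ.filter fun u : Fin n → U => InTypeClass σ w u ∧ InTypeClass ν u z) := by
    intro u hu
    simp only [mem_filter, mem_univ, true_and] at hu ⊢
    have hu' : ∀ a b c, cnt2 (fun i => (w i, z i)) u (a, c) b = N a b c :=
      fun a b c => by rw [hu, hu₀']
    have h1 : ∀ a b, (cnt2 w u a b : ℝ) = cnt w a * σ a b := by
      intro a b
      rw [← hBr, ← hB, ← cnt3_sum_z w z]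
      simp only [hu']
    refine ⟨h1, ?_⟩
    intro b c
    rw [← cnt3_sum_w w z, ← cnt2_sum_left w u]
    push_cast
    simp only [hu', hN, h1, Finset.sum_mul, hcw]
  have c1 := card_class (fun i => (w i, z i)) u₀
  have c2 := card_class w u₀
  set K := (univ.filter fun u : Fin n → U => ∀ ac b,
        cnt2 (fun i => (w i, z i)) u ac b = cnt2 (fun i => (w i, z i)) u₀ ac b).card with hK
  rw [← hT] at c2
  set T := (univ.filter fun u : Fin n → U => InTypeClass σ w u).card with hTd
  have hKn : (K : ℝ) ≤
      ((univ.filter fun u : Fin n → U => InTypeClass σ w u ∧ InTypeClass ν u z).card : ℝ) := by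
    exact_mod_cast Finset.card_le_card hsub
  have hKpos : 0 < K := by
    rw [hK, Finset.card_pos]; exact ⟨u₀, by simp⟩
  have hTpos : 0 < T := by
    rw [hTd, hT, Finset.card_pos]; exact ⟨u₀, by simp⟩
  have hKr : (0 : ℝ) < K := by exact_mod_cast hKpos
  have hTr : (0 : ℝ) < T := by exact_mod_cast hTpos
  refine ⟨hTpos, le_trans ?_ hKn⟩
  have fne : ∀ k : ℕ, ((k.factorial : ℕ) : ℝ) ≠ 0 := fun k => by exact_mod_cast k.factorial_ne_zero
  have l1 := congrArg (fun k : ℕ => Real.log (k : ℝ)) c1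
  have l2 := congrArg (fun k : ℕ => Real.log (k : ℝ)) c2
  simp only [Nat.cast_mul, Nat.cast_prod] at l1 l2
  rw [Real.log_mul hKr.ne' (Finset.prod_ne_zero_iff.2 fun _ _ => fne _),
    Real.log_prod (fun _ _ => fne _), Real.log_prod (fun _ _ => fne _)] at l1
  rw [Real.log_mul hTr.ne' (Finset.prod_ne_zero_iff.2 fun _ _ => fne _),
    Real.log_prod (fun _ _ => fne _), Real.log_prod (fun _ _ => fne _)] at l2
  simp only [Fintype.sum_prod_type, hu₀', hcz] at l1 l2
  have key := entropy_bound n hn N (cnt w) (cnt2 w u₀) (cnt2 w z) hB hG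
    (fun a => cnt2_sum_right w u₀ a) (fun a => cnt_le w a)
    (fun a b c => by rw [← hu₀']; exact cnt2_le _ _ _ _)
  have hI : (n : ℝ) * condMutInfo ν σ τ * Real.log 2 = ∑ a, ∑ b, ∑ c, (N a b c : ℝ) *
        (Real.log (N a b c) + Real.log (cnt w a) - Real.log (cnt2 w u₀ a b)
          - Real.log (cnt2 w z a c)) := by
    unfold condMutInfo
    simp only [Finset.mul_sum, Finset.sum_mul]
    refine sum_congr rfl fun a _ => sum_congr rfl fun b _ => sum_congr rfl fun c _ => ?_
    rw [hBr, hz a c, hcw, hN]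
    by_cases h0 : τ a * σ a b * ν b c = 0
    · rw [h0, show (n : ℝ) * τ a * σ a b * ν b c = n * (τ a * σ a b * ν b c) by ring, h0]
      simp
    · have t0 : τ a ≠ 0 := fun h => h0 (by simp [h])
      have s0 : σ a b ≠ 0 := fun h => h0 (by simp [h])
      have v0 : ν b c ≠ 0 := fun h => h0 (by simp [h])
      have hc := comp_pos hσ0 hν0 a b c (lt_of_le_of_ne (mul_nonneg (hσ0 _ _) (hν0 _ _))
        (mul_ne_zero s0 v0).symm)
      rw [Real.logb, Real.log_div v0 hc.ne', Real.log_mul (by positivity) v0,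
        Real.log_mul (by positivity) s0, Real.log_mul (by positivity) hc.ne']
      have : Real.log 2 ≠ 0 := (Real.log_pos (by norm_num)).ne'
      field_simp
      ring
  rw [← hI] at key
  have hcomm : ∑ a, ∑ c, ∑ b, Real.log ((N a b c).factorial)
      = ∑ a, ∑ b, ∑ c, Real.log ((N a b c).factorial) :=
    sum_congr rfl fun a _ => Finset.sum_comm
  have hle : -((n : ℝ) * condMutInfo ν σ τ * Real.log 2)
      - ((Fintype.card W * Fintype.card U * Fintype.card Z + Fintype.card W : ℕ) : ℝ)
          * (Real.log n + 1) ≤ Real.log K - Real.log T := by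
    linarith
  calc _ ≤ Real.exp (Real.log K - Real.log T) * T := by gcongr
    _ = K := by
      rw [Real.exp_sub, Real.exp_log hKr, Real.exp_log hTr]
      field_simp

open Finset in
lemma exists_disjoint {ι : Type*} [DecidableEq ι] {j : ℕ} (Ms : Fin j → Finset ι) :
    ∃ S : Fin j → Finset ι, (∀ i, S i ⊆ Ms i) ∧ (∀ i, (S i).card = (Ms i).card / j) ∧
      ∀ i i' m, m ∈ S i → m ∈ S i' → i = i' := by
  obtain ⟨f, hf, hfm⟩ := (Finset.all_card_le_biUnion_card_iff_exists_injective
    (fun x : (Σ i : Fin j, Fin ((Ms i).card / j)) => Ms x.1)).1 (by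
      intro s
      rcases s.eq_empty_or_nonempty with rfl | hs
      · simp
      obtain ⟨x, hx, hmax⟩ := s.exists_max_image (fun x => (Ms x.1).card) hs
      have h1 : s.card ≤ ((Ms x.1).card / j) * (s.image Sigma.fst).card := by
        refine Finset.card_le_mul_card_image s _ ?_
        intro i hi
        obtain ⟨y, hy, rfl⟩ := Finset.mem_image.1 hi
        have h2 : (s.filter fun a => a.1 = y.1).card ≤ (Ms y.1).card / j := by
          have : (s.filter fun a => a.1 = y.1) ⊆
              (univ : Finset (Fin ((Ms y.1).card / j))).image (fun k => ⟨y.1, k⟩) := by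
            rintro ⟨i, k⟩ hik
            rw [mem_filter] at hik
            obtain ⟨_, h⟩ := hik
            simp only at h
            subst h
            simp
          refine (Finset.card_le_card this).trans (Finset.card_image_le.trans ?_)
          simp
        exact h2.trans (Nat.div_le_div_right (hmax y hy))
      have h3 : (s.image Sigma.fst).card ≤ j := (Finset.card_le_univ _).trans (by simp)
      calc s.card ≤ ((Ms x.1).card / j) * j := h1.trans (Nat.mul_le_mul_left _ h3)
        _ ≤ (Ms x.1).card := Nat.div_mul_le_self _ _
        _ ≤ _ := Finset.card_le_card (Finset.subset_biUnion_of_mem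
          (fun x : (Σ i : Fin j, Fin ((Ms i).card / j)) => Ms x.1) hx))
  refine ⟨fun i => univ.image fun k => f ⟨i, k⟩, ?_, ?_, ?_⟩
  · intro i m hm
    obtain ⟨k, _, rfl⟩ := Finset.mem_image.1 hm
    exact hfm ⟨i, k⟩
  · intro i
    rw [Finset.card_image_of_injective]
    · simp
    · intro k k' h
      simpa using hf h
  · intro i i' m hm hm'
    obtain ⟨k, _, rfl⟩ := Finset.mem_image.1 hm
    obtain ⟨k', _, h⟩ := Finset.mem_image.1 hm'
    have := hf h
    exact (congrArg Sigma.fst this).symm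

open Finset in
lemma indep_expect {ι κ X : Type*} [Fintype ι] [DecidableEq ι] [Fintype κ] [DecidableEq κ]
    (A : ι → Finset X) (hA : ∀ m, (A m).Nonempty)
    (S : κ → Finset ι) (hS : ∀ i i' m, m ∈ S i → m ∈ S i' → i = i')
    (g : κ → ι → X → ℝ) :
    ∑ f ∈ Fintype.piFinset A, (∏ i, (1 - ∏ m ∈ S i, g i m (f m))) * ∏ m, ((A m).card : ℝ)⁻¹
      = ∏ i, (1 - ∏ m ∈ S i, (∑ x ∈ A m, g i m x * ((A m).card : ℝ)⁻¹)) := by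
  simp only [sub_eq_add_neg, Finset.prod_one_add, Finset.prod_neg, Finset.sum_mul]
  rw [Finset.sum_comm]
  refine sum_congr rfl fun T _ => ?_
  simp only [mul_assoc]
  rw [← Finset.mul_sum]
  congr 1
  have swap : ∀ h : κ → ι → ℝ, ∏ i ∈ T, ∏ m ∈ S i, h i m
      = ∏ m, ∏ i ∈ T.filter (fun i => m ∈ S i), h i m := by
    intro h
    rw [Finset.prod_comm' (t' := univ) (s' := fun m => T.filter (fun i => m ∈ S i))]
    intro i m
    simp
  rw [swap]
  simp only [swap (fun i m => g i m _), ← Finset.prod_mul_distrib]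
  rw [← Finset.prod_univ_sum A (fun m x =>
    (∏ i ∈ T.filter (fun i => m ∈ S i), g i m x) * ((A m).card : ℝ)⁻¹)]
  refine prod_congr rfl fun m _ => ?_
  have hne : ((A m).card : ℝ) ≠ 0 := by
    have := (hA m).card_pos
    positivity
  have h1 : (T.filter (fun i => m ∈ S i)).card ≤ 1 := by
    rw [Finset.card_le_one]
    intro a ha b hb
    rw [mem_filter] at ha hb
    exact hS a b m ha.2 hb.2
  rcases Nat.le_one_iff_eq_zero_or_eq_one.1 h1 with h | h
  · rw [Finset.card_eq_zero] at h
    rw [h]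
    simp [hne]
  · obtain ⟨i, hi⟩ := Finset.card_eq_one.1 h
    rw [hi]
    simp

open Finset Classical in
lemma indep_lower {ι κ X : Type*} [Fintype ι] [DecidableEq ι] [Fintype κ] [DecidableEq κ]
    (A : ι → Finset X) (hA : ∀ m, (A m).Nonempty)
    (S : κ → Finset ι) (hS : ∀ i i' m, m ∈ S i → m ∈ S i' → i = i')
    (P : κ → ι → X → Prop) (p : κ → ℝ) (hp0 : ∀ i, 0 ≤ p i) (hp1 : ∀ i, p i ≤ 1)
    (hp : ∀ i, ∀ m ∈ S i, p i * ((A m).card : ℝ) ≤ (((A m).filter (P i m)).card : ℝ)) :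
    ∏ i, (1 - (1 - p i) ^ (S i).card) ≤
      (((Fintype.piFinset A).filter fun f => ∀ i, ∃ m ∈ S i, P i m (f m)).card : ℝ)
        / ((Fintype.piFinset A).card : ℝ) := by
  have h := indep_expect A hA S hS (fun i m x => if P i m x then 0 else 1)
  have hne : ∀ m, (0 : ℝ) < ((A m).card : ℝ) := by
    intro m
    have := (hA m).card_pos
    positivity
  have hR : (((Fintype.piFinset A).filter fun f => ∀ i, ∃ m ∈ S i, P i m (f m)).card : ℝ)
        / ((Fintype.piFinset A).card : ℝ) = 
        ∏ i, (1 - ∏ m ∈ S i, (∑ x ∈ A m, (if P i m x then 0 else 1) * ((A m).card : ℝ)⁻¹)) := by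
    rw [← h, ← Finset.sum_mul, Fintype.card_piFinset, Nat.cast_prod, Finset.prod_inv_distrib,
      div_eq_mul_inv]
    congr 1
    rw [Finset.card_filter, Nat.cast_sum]
    refine sum_congr rfl fun f _ => ?_
    split_ifs with hf
    · rw [Nat.cast_one]
      symm
      refine Finset.prod_eq_one fun i _ => ?_
      obtain ⟨m, hm, hm'⟩ := hf i
      rw [Finset.prod_eq_zero hm (by simp [hm'])]
      simp
    · push Not at hf
      obtain ⟨i, hi⟩ := hf
      rw [Nat.cast_zero]
      symm
      refine Finset.prod_eq_zero (mem_univ i) ?_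
      rw [Finset.prod_eq_one]
      · simp
      · intro m hm
        simp [hi m hm]
  rw [hR]
  refine Finset.prod_le_prod (fun i _ => ?_) (fun i _ => ?_)
  · have : (1 - p i) ^ (S i).card ≤ 1 :=
      pow_le_one₀ (by linarith [hp1 i]) (by linarith [hp0 i])
    linarith
  · have : ∏ m ∈ S i, (∑ x ∈ A m, (if P i m x then 0 else 1) * ((A m).card : ℝ)⁻¹)
        ≤ (1 - p i) ^ (S i).card := by
      rw [← Finset.prod_const]
      refine Finset.prod_le_prod (fun m _ => ?_) (fun m hm => ?_)
      · refine Finset.sum_nonneg fun x _ => ?_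
        have := (hne m).le
        split_ifs <;> positivity
      · rw [← Finset.sum_mul]
        have e1 : ∑ x ∈ A m, (if P i m x then (0 : ℝ) else 1)
            = (A m).card - ((A m).filter (P i m)).card := by
          have : ∀ x, (if P i m x then (0 : ℝ) else 1) = 1 - (if P i m x then 1 else 0) := by
            intro x; split_ifs <;> simp
          simp only [this, Finset.sum_sub_distrib, Finset.sum_boole]
          simp
        rw [e1, ← div_eq_mul_inv, div_le_iff₀ (hne m)]
        linarith [hp i m hm]
    linarith

lemma one_sub_pow_lower (p : ℝ) (hp0 : 0 ≤ p) (hp1 : p ≤ 1) (k : ℕ) :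
    min (k * p) 1 / 2 ≤ 1 - (1 - p) ^ k := by
  have h1 : 1 + (k : ℝ) * p ≤ (1 + p) ^ k := one_add_mul_le_pow (by linarith) k
  have h2 : (1 - p) ^ k * (1 + p) ^ k ≤ 1 := by
    rw [← mul_pow]
    refine pow_le_one₀ ?_ ?_ <;> nlinarith
  have h3 : 0 ≤ (1 - p) ^ k := pow_nonneg (by linarith) k
  have h4 : (1 - p) ^ k * (1 + k * p) ≤ 1 := (mul_le_mul_of_nonneg_left h1 h3).trans h2
  have h5 : 0 ≤ (k : ℝ) * p := by positivity
  set x := (k : ℝ) * p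
  set q := (1 - p) ^ k
  rcases le_total x 1 with h | h
  · rw [min_eq_left h]; nlinarith
  · rw [min_eq_right h]; nlinarith

lemma round_bound (n j D k M : ℕ) (hn : 2 ≤ n) (hj : 1 ≤ j) (hk : k = M / j) (hM : j ≤ M)
    (I p : ℝ) (hp : p = Real.exp (-((n : ℝ) * I * Real.log 2) - (D : ℝ) * (Real.log n + 1))) :
    0 < min ((k : ℝ) * p) 1 / 2 ∧
    min (Real.logb 2 M - n * I) 0 - (3 * (D : ℝ) + 2) * Real.logb 2 ((n : ℝ) * j)
      ≤ Real.logb 2 (min ((k : ℝ) * p) 1 / 2) := by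
  have hj0 : (0 : ℝ) < j := by exact_mod_cast hj
  have hn0 : (0 : ℝ) < n := by exact_mod_cast (by omega : 0 < n)
  have hM0 : (0 : ℝ) < M := by exact_mod_cast (by omega : 0 < M)
  have hk1 : 1 ≤ k := by rw [hk]; exact (Nat.one_le_div_iff (by omega)).2 hM
  have hk0 : (0 : ℝ) < k := by exact_mod_cast hk1
  have hkM : M ≤ 2 * j * k := by
    have h1 := Nat.lt_mul_div_succ M (show 0 < j by omega)
    rw [← hk] at h1
    nlinarith
  have hp0 : 0 < p := by rw [hp]; exact Real.exp_pos _
  have hx0 : 0 < (k : ℝ) * p := by positivity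
  have hmin : 0 < min ((k : ℝ) * p) 1 := lt_min hx0 one_pos
  refine ⟨by positivity, ?_⟩
  have hl2 : 0 < Real.log 2 := Real.log_pos (by norm_num)
  have hlogn : 1 ≤ Real.logb 2 n := by
    rw [Real.le_logb_iff_rpow_le (by norm_num) hn0]
    simpa using (by exact_mod_cast hn : (2 : ℝ) ≤ n)
  have hlogj : 0 ≤ Real.logb 2 j := Real.logb_nonneg (by norm_num) (by exact_mod_cast hj)
  have hnj : Real.logb 2 ((n : ℝ) * j) = Real.logb 2 n + Real.logb 2 j :=
    Real.logb_mul hn0.ne' hj0.ne'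
  have hlp : Real.logb 2 p = -(n * I) - D * (Real.logb 2 n + 1 / Real.log 2) := by
    rw [hp, Real.logb, Real.log_exp, Real.logb]
    field_simp
  have hinv : 1 / Real.log 2 ≤ 2 := by
    rw [div_le_iff₀ hl2]
    linarith [Real.log_two_gt_d9]
  have hD : (0 : ℝ) ≤ D := Nat.cast_nonneg D
  have hlk : Real.logb 2 M ≤ 1 + Real.logb 2 j + Real.logb 2 k := by
    have : Real.logb 2 M ≤ Real.logb 2 (2 * j * k) :=
      Real.logb_le_logb_of_le (by norm_num) hM0 (by exact_mod_cast hkM)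
    rw [Real.logb_mul (by positivity) hk0.ne', Real.logb_mul (by norm_num) hj0.ne',
      Real.logb_self_eq_one (by norm_num)] at this
    exact this
  have hDn : (D : ℝ) * (Real.logb 2 n + 1 / Real.log 2) ≤ 3 * D * Real.logb 2 n := by
    have : Real.logb 2 n + 1 / Real.log 2 ≤ 3 * Real.logb 2 n := by linarith
    calc _ ≤ (D : ℝ) * (3 * Real.logb 2 n) := by gcongr
      _ = _ := by ring
  have hDj : 0 ≤ (D : ℝ) * Real.logb 2 j := by positivity
  have hDn0 : 0 ≤ (D : ℝ) * Real.logb 2 n := by positivity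
  rw [Real.logb_div hmin.ne' (by norm_num), Real.logb_self_eq_one (by norm_num), hnj]
  rcases le_total ((k : ℝ) * p) 1 with h | h
  · rw [min_eq_left h, Real.logb_mul hk0.ne' hp0.ne', hlp]
    have := min_le_left (Real.logb 2 M - n * I) 0
    nlinarith
  · rw [min_eq_right h, Real.logb_one]
    have := min_le_right (Real.logb 2 M - n * I) 0
    nlinarith

open Classical in
/-- **Lemma 4** (joint typicality over multiple rounds).  For independent
`U_m` uniform on `T_σ(w_m)` and index sets `M_i` with `|M_i| ≥ 8·j·ln j`,
the probability (written as a ratio of counts over the admissible tuples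
`(u_m)_{m ∈ ∪ M_i}`) that in every round `i` the observation `z_i` is
`ν_i`-typical with some `U_m`, `m ∈ M_i`, has a logarithm at least
`∑ i, min(log₂|M_i| − n·I(ν_i,σ|τ), 0) − C·j·log₂(n·j)`. -/
theorem multi_round_typicality {Z U W : Type*}
    [Fintype Z] [Fintype U] [Fintype W]
    [DecidableEq Z] [DecidableEq U] [DecidableEq W] :
    ∃ C : ℝ, 0 < C ∧
      ∀ n : ℕ, 2 ≤ n → ∀ j : ℕ, 1 ≤ j →
      ∀ (τ : W → ℝ) (σ : W → U → ℝ),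
        IsTypeDist n τ → IsCondType n τ σ → Deterministic σ →
      ∀ (ι : Type) (_ : Fintype ι) (_ : DecidableEq ι)
        (Ms : Fin j → Finset ι) (w : ι → Fin n → W),
        (∀ i, 8 * (j : ℝ) * Real.log j ≤ ((Ms i).card : ℝ)) →
        (∀ m ∈ Finset.univ.biUnion Ms, empDist (w m) = τ) →
      ∀ (ν : Fin j → U → Z → ℝ), (∀ i, IsCondType n (marg σ τ) (ν i)) →
      ∀ (z : Fin j → Fin n → Z),
        (∀ i, ∀ m ∈ Ms i, InTypeClass (comp (ν i) σ) (w m) (z i)) →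
        (∑ i, min (Real.logb 2 ((Ms i).card) - (n : ℝ) * condMutInfo (ν i) σ τ) 0)
            - C * (j : ℝ) * Real.logb 2 ((n : ℝ) * (j : ℝ))
          ≤ Real.logb 2
              (((Finset.univ.filter fun f : ι → Fin n → U =>
                    (∀ m ∈ Finset.univ.biUnion Ms, InTypeClass σ (w m) (f m)) ∧
                    ∀ i, ∃ m ∈ Ms i, InTypeClass (ν i) (f m) (z i)).card : ℝ) /
                ((Finset.univ.filter fun f : ι → Fin n → U =>
                    ∀ m ∈ Finset.univ.biUnion Ms, InTypeClass σ (w m) (f m)).card : ℝ)) := by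
  set D : ℕ := Fintype.card W * Fintype.card U * Fintype.card Z + Fintype.card W with hDdef
  refine ⟨3 * (D : ℝ) + 2, by positivity, ?_⟩
  intro n hn j hj τ σ hτ hσ hdet ι _ _ Ms w hMs hw ν hν z hz
  by_cases hcard : ∀ i, j ≤ (Ms i).card
  swap
  · push Not at hcard
    obtain ⟨i, hi⟩ := hcard
    have hj1 : j = 1 := by
      by_contra hne
      have h2 : 2 ≤ j := by omega
      have h2r : (2 : ℝ) ≤ j := by exact_mod_cast h2
      have hl : Real.log 2 ≤ Real.log j := Real.log_le_log (by norm_num) h2r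
      have h3 := hMs i
      have h4 : ((Ms i).card : ℝ) < j := by exact_mod_cast hi
      nlinarith [Real.log_two_gt_d9]
    have hempty : Ms i = ∅ := by
      rw [← Finset.card_eq_zero]; omega
    rw [Finset.filter_false_of_mem (s := Finset.univ) (p := fun f : ι → Fin n → U =>
                    (∀ m ∈ Finset.univ.biUnion Ms, InTypeClass σ (w m) (f m)) ∧
                    ∀ i, ∃ m ∈ Ms i, InTypeClass (ν i) (f m) (z i))]
    · simp only [Finset.card_empty, Nat.cast_zero, zero_div, Real.logb_zero]
      have h1 : ∑ i, min (Real.logb 2 ((Ms i).card) - (n : ℝ) * condMutInfo (ν i) σ τ) 0 ≤ 0 :=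
        Finset.sum_nonpos fun i _ => min_le_right _ _
      have h2 : 0 ≤ Real.logb 2 ((n : ℝ) * (j : ℝ)) := by
        refine Real.logb_nonneg (by norm_num) ?_
        exact_mod_cast Nat.one_le_iff_ne_zero.2 (Nat.mul_ne_zero (by omega) (by omega))
      have h3 : 0 ≤ (3 * (D : ℝ) + 2) * (j : ℝ) * Real.logb 2 ((n : ℝ) * (j : ℝ)) := by positivity
      linarith
    · rintro f _ ⟨_, h⟩
      obtain ⟨m, hm, _⟩ := h i
      rw [hempty] at hm
      simp at hm
  obtain ⟨S, hSM, hSc, hSd⟩ := exists_disjoint Ms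
  have hmem : ∀ i, ∀ m ∈ Ms i, m ∈ Finset.univ.biUnion Ms := fun i m hm =>
    Finset.mem_biUnion.2 ⟨i, Finset.mem_univ _, hm⟩
  have hS1 : ∀ i, (S i).Nonempty := by
    intro i
    rw [← Finset.card_pos, hSc]
    exact Nat.div_pos (hcard i) (by omega)
  have hsingle := fun i m (hm : m ∈ Ms i) => single_lower n (by omega) τ σ hτ hσ hdet (w m)
    (hw m (hmem i m hm)) (ν i) (hν i) (z i) (hz i m hm)
  set A : ι → Finset (Fin n → U) := fun m => Finset.univ.filter fun u =>
    m ∈ Finset.univ.biUnion Ms → InTypeClass σ (w m) u with hAdef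
  have hAm : ∀ m ∈ Finset.univ.biUnion Ms,
      A m = Finset.univ.filter fun u => InTypeClass σ (w m) u := by
    intro m hm
    ext u
    simp only [hAdef, Finset.mem_filter, hm, true_implies]
  have hAin : ∀ m ∈ Finset.univ.biUnion Ms, (A m).Nonempty := by
    intro m hm
    rw [hAm m hm]
    obtain ⟨i, _, hi⟩ := Finset.mem_biUnion.1 hm
    exact Finset.card_pos.1 (hsingle i m hi).1
  have hA : ∀ m, (A m).Nonempty := by
    intro m
    by_cases hm : m ∈ Finset.univ.biUnion Ms
    · exact hAin m hm
    · obtain ⟨m', hm'⟩ := hS1 ⟨0, hj⟩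
      obtain ⟨u, _⟩ := hAin m' (hmem _ _ (hSM _ hm'))
      exact ⟨u, Finset.mem_filter.2 ⟨Finset.mem_univ _, fun h => absurd h hm⟩⟩
  set p : Fin j → ℝ := fun i => Real.exp (-((n : ℝ) * condMutInfo (ν i) σ τ * Real.log 2)
      - (D : ℝ) * (Real.log n + 1)) with hpdef
  have hp : ∀ i, ∀ m ∈ S i, p i * ((A m).card : ℝ)
      ≤ (((A m).filter fun u => InTypeClass (ν i) u (z i)).card : ℝ) := by
    intro i m hm
    have h := (hsingle i m (hSM i hm)).2
    rw [hAm m (hmem i m (hSM i hm)), Finset.filter_filter]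
    exact h
  have hp1 : ∀ i, p i ≤ 1 := by
    intro i
    obtain ⟨m, hm⟩ := hS1 i
    have h1 := hp i m hm
    have h2 : (((A m).filter fun u => InTypeClass (ν i) u (z i)).card : ℝ) ≤ (A m).card := by
      exact_mod_cast Finset.card_filter_le _ _
    have h3 : (0 : ℝ) < (A m).card := by exact_mod_cast (hA m).card_pos
    by_contra hlt
    push Not at hlt
    nlinarith
  have hp0 : ∀ i, 0 ≤ p i := fun i => (Real.exp_pos _).le
  have hind := indep_lower A hA S hSd (fun i _ u => InTypeClass (ν i) u (z i)) p hp0 hp1 hp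
  have hround := fun i => round_bound n j D (S i).card (Ms i).card hn hj (hSc i) (hcard i)
    (condMutInfo (ν i) σ τ) (p i) rfl
  have hden : (Finset.univ.filter fun f : ι → Fin n → U =>
      ∀ m ∈ Finset.univ.biUnion Ms, InTypeClass σ (w m) (f m)) = Fintype.piFinset A := by
    ext f
    simp only [hAdef, Finset.mem_filter, Finset.mem_univ, true_and, Fintype.mem_piFinset]
  have hnum : ((Fintype.piFinset A).filter fun f => ∀ i, ∃ m ∈ S i, InTypeClass (ν i) (f m) (z i))
      ⊆ (Finset.univ.filter fun f : ι → Fin n → U =>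
                    (∀ m ∈ Finset.univ.biUnion Ms, InTypeClass σ (w m) (f m)) ∧
                    ∀ i, ∃ m ∈ Ms i, InTypeClass (ν i) (f m) (z i)) := by
    intro f hf
    rw [Finset.mem_filter, ← hden, Finset.mem_filter] at hf
    refine Finset.mem_filter.2 ⟨Finset.mem_univ _, hf.1.2, fun i => ?_⟩
    obtain ⟨m, hm, h⟩ := hf.2 i
    exact ⟨m, hSM i hm, h⟩
  rw [hden]
  have hprod : ∏ i, (min (((S i).card : ℝ) * p i) 1 / 2) ≤ ∏ i, (1 - (1 - p i) ^ (S i).card) :=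
    Finset.prod_le_prod (fun i _ => (hround i).1.le)
      (fun i _ => one_sub_pow_lower (p i) (hp0 i) (hp1 i) _)
  have hpos : 0 < ∏ i, (min (((S i).card : ℝ) * p i) 1 / 2) :=
    Finset.prod_pos fun i _ => (hround i).1
  have hfin := (hprod.trans hind).trans (div_le_div_of_nonneg_right
    (Nat.cast_le (α := ℝ).2 (le_trans (le_of_eq (by congr)) (Finset.card_le_card hnum)))
    (Nat.cast_nonneg (α := ℝ) _))
  refine le_trans ?_ (Real.logb_le_logb_of_le (by norm_num) hpos hfin)
  rw [Real.logb_prod _ _ (fun i _ => (hround i).1.ne')]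
  refine le_trans (le_of_eq ?_) (Finset.sum_le_sum fun i _ => (hround i).2)
  rw [Finset.sum_sub_distrib, Finset.sum_const, Finset.card_univ, Fintype.card_fin, nsmul_eq_mul]
  ring

end Types
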